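/- Random matrix product states form an exact 1-design: E_{ψ ∼ μ_{d,n,D}} |ψ⟩⟨ψ| = d^{−n} · 1_{(ℂ^d)^{⊗n}}; in particular E_{ψ ∼ μ_{d,n,D}} ⟨ψ|ψ⟩ = 1. -/

import Mathlib

open MeasureTheory Matrix
open scoped ComplexConjugate

noncomputable section

instance matrixMeasurableSpace {m n : Type*} : MeasurableSpace (Matrix m n ℂ) :=
  MeasurableSpace.pi

/-- The site tensor `A^{(m)}_i = (⟨i| ⊗ 1_D) U (|0⟩ ⊗ 1_D)`. -/
def siteMat (d D : ℕ) [NeZero d] (U : Matrix.unitaryGroup (Fin d × Fin D) ℂ) (i : Fin d) :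
    Matrix (Fin D) (Fin D) ℂ :=
  Matrix.of fun a b => (U : Matrix (Fin d × Fin D) (Fin d × Fin D) ℂ) (i, a) (0, b)

/-- The (unnormalized) matrix product state `ψ`, with periodic boundary conditions:
`ψ(i₁,…,iₙ) = Tr[A^{(1)}_{i₁} ⋯ A^{(n)}_{iₙ}]`. -/
def mps (d D n : ℕ) [NeZero d] (U : Fin n → Matrix.unitaryGroup (Fin d × Fin D) ℂ) :
    (Fin n → Fin d) → ℂ :=
  fun idx => Matrix.trace (((List.finRange n).map fun m => siteMat d D (U m) (idx m)).prod)


lemma meas_entry {ι : Type*} [Fintype ι] [DecidableEq ι] (p q : ι) :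
    Measurable fun U : Matrix.unitaryGroup ι ℂ => (U : Matrix ι ι ℂ) p q :=
  (measurable_pi_apply q).comp ((measurable_pi_apply p).comp measurable_subtype_coe)

lemma meas_mul {ι : Type*} [Fintype ι] [DecidableEq ι] (V : Matrix.unitaryGroup ι ℂ) :
    Measurable fun U : Matrix.unitaryGroup ι ℂ => V * U := by
  apply Measurable.subtype_mk
  refine measurable_pi_iff.2 fun p => measurable_pi_iff.2 fun q => ?_
  simp only [Matrix.mul_apply]
  exact Finset.measurable_sum _ fun k _ => (meas_entry k q).const_mul _

lemma integrable_second {ι : Type*} [Fintype ι] [DecidableEq ι]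
    (μ : Measure (Matrix.unitaryGroup ι ℂ)) [IsProbabilityMeasure μ] (p q r s : ι) :
    Integrable (fun U : Matrix.unitaryGroup ι ℂ =>
      (U : Matrix ι ι ℂ) p q * conj ((U : Matrix ι ι ℂ) r s)) μ := by
  refine Integrable.of_bound (C := 1) ?_ ?_
  · exact ((meas_entry p q).mul
      (Complex.continuous_conj.measurable.comp (meas_entry r s))).aestronglyMeasurable
  · refine Filter.Eventually.of_forall fun U => ?_
    rw [norm_mul, RCLike.norm_conj]
    exact mul_le_one₀ (entry_norm_bound_of_unitary U.2 _ _) (norm_nonneg _)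
      (entry_norm_bound_of_unitary U.2 _ _)

lemma inv_second {ι : Type*} [Fintype ι] [DecidableEq ι]
    (μ : Measure (Matrix.unitaryGroup ι ℂ))
    (hHaar : ∀ V : Matrix.unitaryGroup ι ℂ, μ.map (fun U => V * U) = μ)
    (V : Matrix.unitaryGroup ι ℂ) (p q r s : ι) :
    ∫ U : Matrix.unitaryGroup ι ℂ, (U : Matrix ι ι ℂ) p q * conj ((U : Matrix ι ι ℂ) r s) ∂μ
    = ∫ U : Matrix.unitaryGroup ι ℂ, ((V : Matrix ι ι ℂ) * (U : Matrix ι ι ℂ)) p q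
        * conj (((V : Matrix ι ι ℂ) * (U : Matrix ι ι ℂ)) r s) ∂μ := by
  conv_lhs => rw [← hHaar V]
  rw [integral_map (meas_mul V).aemeasurable]
  · rfl
  · exact ((meas_entry p q).mul
      (Complex.continuous_conj.measurable.comp (meas_entry r s))).aestronglyMeasurable

lemma second_off {ι : Type*} [Fintype ι] [DecidableEq ι]
    (μ : Measure (Matrix.unitaryGroup ι ℂ))
    (hHaar : ∀ V : Matrix.unitaryGroup ι ℂ, μ.map (fun U => V * U) = μ)
    (p q r s : ι) (h : p ≠ r) :
    ∫ U : Matrix.unitaryGroup ι ℂ, (U : Matrix ι ι ℂ) p q * conj ((U : Matrix ι ι ℂ) r s) ∂μ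
    = 0 := by
  have hV : Matrix.diagonal (fun k : ι => if k = p then (-1 : ℂ) else 1)
      ∈ Matrix.unitaryGroup ι ℂ := by
    rw [Matrix.mem_unitaryGroup_iff, Matrix.star_eq_conjTranspose, Matrix.diagonal_conjTranspose,
      Matrix.diagonal_mul_diagonal, ← Matrix.diagonal_one]
    congr 1
    funext k
    by_cases hk : k = p <;> simp [hk]
  have := inv_second μ hHaar ⟨_, hV⟩ p q r s
  simp only [Matrix.diagonal_mul, if_neg h.symm] at this
  simp only [if_true, one_mul, neg_mul, integral_neg] at this
  exact self_eq_neg.1 this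

lemma second_diag {ι : Type*} [Fintype ι] [DecidableEq ι]
    (μ : Measure (Matrix.unitaryGroup ι ℂ)) [IsProbabilityMeasure μ]
    (hHaar : ∀ V : Matrix.unitaryGroup ι ℂ, μ.map (fun U => V * U) = μ)
    (p q s : ι) :
    ∫ U : Matrix.unitaryGroup ι ℂ, (U : Matrix ι ι ℂ) p q * conj ((U : Matrix ι ι ℂ) p s) ∂μ
    = if q = s then ((Fintype.card ι : ℂ))⁻¹ else 0 := by
  have heq : ∀ r, ∫ U : Matrix.unitaryGroup ι ℂ,
      (U : Matrix ι ι ℂ) r q * conj ((U : Matrix ι ι ℂ) r s) ∂μ =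
      ∫ U : Matrix.unitaryGroup ι ℂ,
      (U : Matrix ι ι ℂ) p q * conj ((U : Matrix ι ι ℂ) p s) ∂μ := by
    intro r
    have hV : (Equiv.swap p r).toPEquiv.toMatrix ∈ Matrix.unitaryGroup ι ℂ := by
      rw [Matrix.mem_unitaryGroup_iff, Matrix.star_eq_conjTranspose]
      ext i j
      rw [PEquiv.toMatrix_toPEquiv_mul]
      simp [Matrix.conjTranspose_apply, PEquiv.toMatrix_apply, Matrix.one_apply, eq_comm]
    have := inv_second μ hHaar ⟨_, hV⟩ r q r s
    rw [this]
    simp only [PEquiv.toMatrix_toPEquiv_mul, Matrix.submatrix_apply, Equiv.swap_apply_right, id]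
  have hsum : ∑ r, ∫ U : Matrix.unitaryGroup ι ℂ,
      (U : Matrix ι ι ℂ) r q * conj ((U : Matrix ι ι ℂ) r s) ∂μ = if q = s then 1 else 0 := by
    rw [← integral_finsetSum _ fun r _ => integrable_second μ r q r s]
    have : ∀ U : Matrix.unitaryGroup ι ℂ,
      ∑ r, (U : Matrix ι ι ℂ) r q * conj ((U : Matrix ι ι ℂ) r s) = if q = s then 1 else 0 := by
      intro U
      have h := congrFun (congrFun (Matrix.mem_unitaryGroup_iff'.1 U.2) s) q
      rw [Matrix.mul_apply, Matrix.one_apply] at h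
      simp only [Matrix.star_apply, eq_comm (a := s)] at h
      rw [← h]
      exact Finset.sum_congr rfl fun r _ => mul_comm _ _
    simp [this]
  simp only [heq, Finset.sum_const, Finset.card_univ, nsmul_eq_mul] at hsum
  have : (Fintype.card ι : ℂ) ≠ 0 := by
    have : Nonempty ι := ⟨p⟩
    exact_mod_cast Fintype.card_ne_zero
  rw [← mul_right_inj' this, hsum]
  split_ifs <;> simp [this]

/-- partial product -/
def pp (d D n : ℕ) [NeZero d] (U : Fin n → Matrix.unitaryGroup (Fin d × Fin D) ℂ)
    (x : Fin n → Fin d) : Matrix (Fin D) (Fin D) ℂ :=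
  ((List.finRange n).map fun m => siteMat d D (U m) (x m)).prod

lemma pp_succ (d D n : ℕ) [NeZero d] (U : Fin (n+1) → Matrix.unitaryGroup (Fin d × Fin D) ℂ)
    (x : Fin (n+1) → Fin d) :
    pp d D (n+1) U x = siteMat d D (U 0) (x 0) * pp d D n (Fin.tail U) (Fin.tail x) := by
  simp only [pp, List.finRange_succ, List.map_cons, List.prod_cons, List.map_map]
  rfl

lemma mp_tail {α : Type*} [MeasurableSpace α] (μ : Measure α) [IsProbabilityMeasure μ] (n : ℕ) :
    MeasurePreserving (fun U : Fin (n+1) → α => (U 0, Fin.tail U))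
      (Measure.pi fun _ => μ) (μ.prod (Measure.pi fun _ => μ)) :=
  measurePreserving_piFinSuccAbove (fun _ : Fin (n+1) => μ) 0

lemma split_int {α : Type*} [MeasurableSpace α] (μ : Measure α) [IsProbabilityMeasure μ] (n : ℕ)
    (f : α → ℂ) (g : (Fin n → α) → ℂ) (hf : Integrable f μ)
    (hg : Integrable g (Measure.pi fun _ => μ)) :
    Integrable (fun U : Fin (n+1) → α => f (U 0) * g (Fin.tail U)) (Measure.pi fun _ => μ) ∧
    ∫ U : Fin (n+1) → α, f (U 0) * g (Fin.tail U) ∂(Measure.pi fun _ => μ)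
      = (∫ u, f u ∂μ) * ∫ U, g U ∂(Measure.pi fun _ => μ) := by
  have h := hf.mul_prod hg
  refine ⟨(mp_tail μ n).integrable_comp_of_integrable h, ?_⟩
  rw [← integral_prod_mul, ← (mp_tail μ n).map_eq, integral_map
    (mp_tail μ n).measurable.aemeasurable]
  rw [(mp_tail μ n).map_eq]
  exact h.aestronglyMeasurable

lemma expand (d D n : ℕ) [NeZero d] (x y : Fin (n+1) → Fin d) (a b a' b' : Fin D)
    (U : Fin (n+1) → Matrix.unitaryGroup (Fin d × Fin D) ℂ) :
    pp d D (n+1) U x a b * conj (pp d D (n+1) U y a' b') =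
    ∑ c, ∑ c', ((U 0 : Matrix (Fin d × Fin D) (Fin d × Fin D) ℂ) (x 0, a) (0, c) * conj ((U 0 : Matrix (Fin d × Fin D) (Fin d × Fin D) ℂ) (y 0, a') (0, c')))
      * (pp d D n (Fin.tail U) (Fin.tail x) c b *
          conj (pp d D n (Fin.tail U) (Fin.tail y) c' b')) := by
  rw [pp_succ, pp_succ, Matrix.mul_apply, Matrix.mul_apply, map_sum, Finset.sum_mul_sum]
  refine Finset.sum_congr rfl fun c _ => Finset.sum_congr rfl fun c' _ => ?_
  simp only [siteMat, Matrix.of_apply, map_mul]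
  ring

lemma pp_integrable (d D n : ℕ) [NeZero d]
    (μ : Measure (Matrix.unitaryGroup (Fin d × Fin D) ℂ)) [IsProbabilityMeasure μ]
    (x y : Fin n → Fin d) (a b a' b' : Fin D) :
    Integrable (fun U => pp d D n U x a b * conj (pp d D n U y a' b'))
      (Measure.pi fun _ : Fin n => μ) := by
  induction n generalizing a b a' b' with
  | zero => simp [pp]
  | succ n ih =>
    simp only [expand]
    refine integrable_finsetSum _ fun c _ => integrable_finsetSum _ fun c' _ => ?_
    exact (split_int μ n _ _ (integrable_second μ (x 0, a) (0, c) (y 0, a') (0, c'))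
      (ih (Fin.tail x) (Fin.tail y) c b c' b')).1

lemma pp_step (d D n : ℕ) [NeZero d]
    (μ : Measure (Matrix.unitaryGroup (Fin d × Fin D) ℂ)) [IsProbabilityMeasure μ]
    (hHaar : ∀ V : Matrix.unitaryGroup (Fin d × Fin D) ℂ, μ.map (fun U => V * U) = μ)
    (x y : Fin (n+1) → Fin d) (a b a' b' : Fin D) :
    ∫ U, pp d D (n+1) U x a b * conj (pp d D (n+1) U y a' b') ∂(Measure.pi fun _ => μ) =
    if x 0 = y 0 ∧ a = a' then ((d : ℂ) * D)⁻¹ * ∑ c,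
      ∫ U, pp d D n U (Fin.tail x) c b * conj (pp d D n U (Fin.tail y) c b')
        ∂(Measure.pi fun _ => μ) else 0 := by
  have hs := fun c c' => split_int μ n _ _
    (integrable_second μ (x 0, a) (0, c) (y 0, a') (0, c'))
      (pp_integrable d D n μ (Fin.tail x) (Fin.tail y) c b c' b')
  simp only [expand]
  rw [integral_finsetSum _ fun c _ => integrable_finsetSum _ fun c' _ => (hs c c').1]
  simp_rw [integral_finsetSum _ fun c' _ => (hs _ c').1, fun c c' => (hs c c').2]
  split_ifs with h
  · obtain ⟨h1, rfl⟩ := h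
    rw [← h1]
    simp only [second_diag μ hHaar]
    simp [Finset.mul_sum]
  · have : (x 0, a) ≠ (y 0, a') := fun e => h (Prod.mk.injEq .. ▸ e)
    simp [second_off μ hHaar _ _ _ _ this]

lemma fin_eq_iff {d n : ℕ} (x y : Fin (n+1) → Fin d) :
    x = y ↔ x 0 = y 0 ∧ Fin.tail x = Fin.tail y := by
  constructor
  · rintro rfl; simp
  · rintro ⟨h, h'⟩
    rw [← Fin.cons_self_tail x, ← Fin.cons_self_tail y, h, h']

lemma pp_sum (d D n : ℕ) [NeZero d] (hD : D ≠ 0)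
    (μ : Measure (Matrix.unitaryGroup (Fin d × Fin D) ℂ)) [IsProbabilityMeasure μ]
    (hHaar : ∀ V : Matrix.unitaryGroup (Fin d × Fin D) ℂ, μ.map (fun U => V * U) = μ)
    (x y : Fin n → Fin d) (b b' : Fin D) :
    ∑ c, ∫ U, pp d D n U x c b * conj (pp d D n U y c b') ∂(Measure.pi fun _ => μ) =
    if x = y ∧ b = b' then ((d : ℂ) ^ n)⁻¹ else 0 := by
  have hD' : (D : ℂ) ≠ 0 := by exact_mod_cast hD
  have hd' : (d : ℂ) ≠ 0 := by exact_mod_cast NeZero.ne d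
  induction n with
  | zero =>
    have : x = y := Subsingleton.elim _ _
    simp [pp, this, Matrix.one_apply, apply_ite]
    try simp [eq_comm]
  | succ n ih =>
    simp only [pp_step d D n μ hHaar, ih, fin_eq_iff x y]
    by_cases h0 : x 0 = y 0 <;> by_cases h1 : Fin.tail x = Fin.tail y <;> by_cases h2 : b = b' <;>
      simp [h0, h1, h2]
    field_simp
    try ring

lemma mps_expand (d D n : ℕ) [NeZero d] (x y : Fin n → Fin d)
    (U : Fin n → Matrix.unitaryGroup (Fin d × Fin D) ℂ) :
    mps d D n U x * conj (mps d D n U y) =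
      ∑ a, ∑ a', pp d D n U x a a * conj (pp d D n U y a' a') := by
  rw [← Finset.sum_mul_sum, ← map_sum]
  rfl

/-- random matrix product states form an exact 1-design:
`E_{ψ ∼ μ_{d,n,D}} |ψ⟩⟨ψ| = d^{−n}·1` (stated entrywise: the `(x,y)` entry of `|ψ⟩⟨ψ|`
is `ψ(x)·conj(ψ(y))`), and in particular `E ⟨ψ|ψ⟩ = 1`.  The `n` site unitaries are
drawn i.i.d. from the Haar probability measure on `U(dD)` (the unique left-invariant
Borel probability measure on the unitary group). -/
theorem rmps_exact_one_design
    (d D n : ℕ) [NeZero d] (hd : 2 ≤ d) (hD : 2 ≤ D) (hn : 1 ≤ n)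
    (μ : Measure (Matrix.unitaryGroup (Fin d × Fin D) ℂ)) [IsProbabilityMeasure μ]
    (hHaar : ∀ V : Matrix.unitaryGroup (Fin d × Fin D) ℂ, μ.map (fun U => V * U) = μ) :
    (∀ x y : Fin n → Fin d,
      ∫ U, mps d D n U x * conj (mps d D n U y) ∂(Measure.pi fun _ : Fin n => μ)
        = if x = y then ((d : ℂ) ^ n)⁻¹ else 0) ∧
    ∫ U, ∑ x, ‖mps d D n U x‖ ^ 2 ∂(Measure.pi fun _ : Fin n => μ) = 1 := by
  have hD' : (D : ℂ) ≠ 0 := by exact_mod_cast (by omega : D ≠ 0)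
  have hd' : (d : ℂ) ≠ 0 := by exact_mod_cast NeZero.ne d
  have hI := fun (x y : Fin n → Fin d) (a a' : Fin D) => pp_integrable d D n μ x y a a a' a'
  have main : ∀ x y : Fin n → Fin d,
      ∫ U, mps d D n U x * conj (mps d D n U y) ∂(Measure.pi fun _ : Fin n => μ)
        = if x = y then ((d : ℂ) ^ n)⁻¹ else 0 := by
    intro x y
    simp only [mps_expand]
    rw [integral_finsetSum _ fun c _ => integrable_finsetSum _ fun c' _ => hI x y c c']
    simp_rw [integral_finsetSum _ fun c' _ => hI x y _ c']
    obtain ⟨m, rfl⟩ : ∃ m, n = m + 1 := ⟨n - 1, by omega⟩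
    simp only [pp_step d D m μ hHaar, pp_sum d D m (by omega) μ hHaar, fin_eq_iff x y]
    by_cases h0 : x 0 = y 0 <;> by_cases h1 : Fin.tail x = Fin.tail y <;> simp [h0, h1]
    field_simp
    try ring
  refine ⟨main, ?_⟩
  have hc : ((∫ U, ∑ x, ‖mps d D n U x‖ ^ 2 ∂(Measure.pi fun _ : Fin n => μ) : ℝ) : ℂ) = 1 := by
    rw [← integral_complex_ofReal]
    have : ∀ U, ((∑ x, ‖mps d D n U x‖ ^ 2 : ℝ) : ℂ)
        = ∑ x, mps d D n U x * conj (mps d D n U x) := by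
      intro U
      push_cast
      exact Finset.sum_congr rfl fun x _ => (Complex.mul_conj' _).symm
    simp only [this]
    rw [integral_finsetSum]
    · simp [main, hd']
    · intro x _
      simp only [mps_expand]
      exact integrable_finsetSum _ fun c _ => integrable_finsetSum _ fun c' _ => hI x x c c'
  exact_mod_cast hc
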